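/- arXiv:2004.08032 — 4 statements merged into one kernel-verified Lean document; each statement's English description precedes it below -/
import Mathlib

section
/- Let r > 1 and let z satisfy 1 ≤ z < r < ((z + 1)/2)². Then θ*(z, r) is a strict local minimum of θ ↦ ℓ(θ | r, z), every global minimizer of ℓ(· | r, z) lies in {0, θ*(z, r)}, and the global minimizer equals θ*(z, r) if Δ(z | r) < 0, while it equals 0 if Δ(z | r) > 0. -/
/-- The LAAD univariate objective `ℓ(θ | r, z) = (1/2)(z − θ)² + r·log(1 + |θ|)`. -/
noncomputable def laadLoss (r z θ : ℝ) : ℝ :=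
  (1 / 2) * (z - θ) ^ 2 + r * Real.log (1 + |θ|)

/-- For `z ≥ 0`, `θ*(z, r) = (z − 1)/2 + (1/2)√((z − 1)² + 4z − 4r)`. -/
noncomputable def thetaStar (z r : ℝ) : ℝ :=
  (z - 1) / 2 + (1 / 2) * Real.sqrt ((z - 1) ^ 2 + 4 * z - 4 * r)

/-- `Δ(z | r) = (1/2)θ*² − θ*·z + r·log(1 + θ*)` where `θ* = θ*(z, r)`. -/
noncomputable def laadDelta (z r : ℝ) : ℝ :=
  (1 / 2) * (thetaStar z r) ^ 2 - thetaStar z r * z + r * Real.log (1 + thetaStar z r)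

theorem continuous_laadLoss (r z : ℝ) : Continuous (laadLoss r z) := by
  unfold laadLoss
  have h : ∀ θ : ℝ, 1 + |θ| ≠ 0 := fun θ => by positivity
  fun_prop (disch := exact h _)

theorem hasDerivAt_laadLoss (r z : ℝ) {θ : ℝ} (hθ : 0 < θ) :
    HasDerivAt (laadLoss r z) ((θ ^ 2 - (z - 1) * θ + (r - z)) / (1 + θ)) θ := by
  have hlog : HasDerivAt (fun x : ℝ => r * Real.log (1 + x)) (r * (1 / (1 + θ))) θ :=
    (((hasDerivAt_id' θ).const_add 1).log (by positivity)).const_mul r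
  have hsq : HasDerivAt (fun x : ℝ => (1 / 2) * (z - x) ^ 2) (-(z - θ)) θ :=
    ((((hasDerivAt_id' θ).const_sub z).pow 2).const_mul (1 / 2)).congr_deriv (by
      push_cast; ring)
  have hsum : HasDerivAt (fun x : ℝ => (1 / 2) * (z - x) ^ 2 + r * Real.log (1 + x))
      ((θ ^ 2 - (z - 1) * θ + (r - z)) / (1 + θ)) θ :=
    (hsq.add hlog).congr_deriv (by field_simp; ring)
  refine hsum.congr_of_eventuallyEq ?_
  filter_upwards [eventually_gt_nhds hθ] with x hx
  rw [laadLoss, abs_of_pos hx]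

theorem laadLoss_zero_lt_of_neg {r z θ : ℝ} (hr : 0 ≤ r) (hz : 0 ≤ z) (hθ : θ < 0) :
    laadLoss r z 0 < laadLoss r z θ := by
  have hlog : 0 ≤ r * Real.log (1 + |θ|) :=
    mul_nonneg hr (Real.log_nonneg (by linarith [abs_nonneg θ]))
  simp only [laadLoss, abs_zero, add_zero, Real.log_one, mul_zero]
  nlinarith [mul_nonneg hz (neg_pos.2 hθ).le, sq_pos_of_neg hθ]

theorem laadDelta_eq_sub {r z : ℝ} (h : 0 ≤ thetaStar z r) :
    laadDelta z r = laadLoss r z (thetaStar z r) - laadLoss r z 0 := by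
  simp only [laadDelta, laadLoss, abs_of_nonneg h, abs_zero, add_zero, Real.log_one]
  ring

/-- The other stationary point of the loss on the positive half-line is a threshold: up to it the
loss is larger than at `0`, beyond it the loss is larger than at `θ*(z, r)`. -/
theorem exists_laadLoss_threshold {r z : ℝ} (hz : 1 ≤ z) (hzr : z < r)
    (hrz : r < ((z + 1) / 2) ^ 2) :
    ∃ a, 0 < a ∧ a < thetaStar z r ∧
      (∀ θ, θ ≠ 0 → θ ≤ a → laadLoss r z 0 < laadLoss r z θ) ∧
      (∀ θ, θ ≠ thetaStar z r → a ≤ θ → laadLoss r z (thetaStar z r) < laadLoss r z θ) := by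
  have hdisc : 0 < (z - 1) ^ 2 + 4 * z - 4 * r := by nlinarith
  have hsqrt := Real.sqrt_pos.2 hdisc
  have hsq := Real.sq_sqrt hdisc.le
  have hb : thetaStar z r = (z - 1) / 2 + (1 / 2) * √((z - 1) ^ 2 + 4 * z - 4 * r) := rfl
  set b := thetaStar z r
  set s := √((z - 1) ^ 2 + 4 * z - 4 * r)
  obtain ⟨a, ha⟩ : ∃ a, a = z - 1 - b := ⟨_, rfl⟩
  have hab : a < b := by linarith
  have hb0 : 0 < b := by linarith
  have hprod : a * b = r - z := by rw [ha, hb]; linarith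
  have ha0 : 0 < a := pos_of_mul_pos_left (by linarith : 0 < a * b) hb0.le
  have hderiv : ∀ θ, 0 < θ → deriv (laadLoss r z) θ = (θ - a) * (θ - b) / (1 + θ) := by
    intro θ hθ
    rw [(hasDerivAt_laadLoss r z hθ).deriv, ← hprod, show z - 1 = a + b by linarith]
    ring
  have hcont (t : Set ℝ) : ContinuousOn (laadLoss r z) t := (continuous_laadLoss r z).continuousOn
  have hmono₁ : StrictMonoOn (laadLoss r z) (Set.Icc 0 a) := by
    refine strictMonoOn_of_deriv_pos (convex_Icc 0 a) (hcont _) fun θ hθ => ?_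
    rw [interior_Icc] at hθ
    rw [hderiv θ hθ.1]
    exact div_pos (mul_pos_of_neg_of_neg (by linarith [hθ.2]) (by linarith [hθ.2]))
      (by linarith [hθ.1])
  have hanti : StrictAntiOn (laadLoss r z) (Set.Icc a b) := by
    refine strictAntiOn_of_deriv_neg (convex_Icc a b) (hcont _) fun θ hθ => ?_
    rw [interior_Icc] at hθ
    rw [hderiv θ (ha0.trans hθ.1)]
    exact div_neg_of_neg_of_pos (mul_neg_of_pos_of_neg (by linarith [hθ.1]) (by linarith [hθ.2]))
      (by linarith [hθ.1])
  have hmono₂ : StrictMonoOn (laadLoss r z) (Set.Ici b) := by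
    refine strictMonoOn_of_deriv_pos (convex_Ici b) (hcont _) fun θ hθ => ?_
    rw [interior_Ici, Set.mem_Ioi] at hθ
    rw [hderiv θ (hb0.trans hθ)]
    exact div_pos (mul_pos (by linarith) (by linarith)) (by linarith)
  refine ⟨a, ha0, hab, fun θ hθ hθa => ?_, fun θ hθ hθa => ?_⟩
  · rcases hθ.lt_or_gt with h | h
    · exact laadLoss_zero_lt_of_neg (by linarith) (by linarith) h
    · exact hmono₁ ⟨le_rfl, ha0.le⟩ ⟨h.le, hθa⟩ h
  · rcases hθ.lt_or_gt with h | h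
    · exact hanti ⟨hθa, h.le⟩ ⟨hab.le, le_rfl⟩ h
    · exact hmono₂ Set.self_mem_Ici (Set.mem_Ici.2 h.le) h

/-- For `r > 1` and `1 ≤ z < r < ((z + 1)/2)²`: `θ*(z, r)` is a strict local minimum of
`θ ↦ ℓ(θ | r, z)`, every global minimizer lies in `{0, θ*(z, r)}`, and the global minimizer
equals `θ*(z, r)` if `Δ(z | r) < 0`, while it equals `0` if `Δ(z | r) > 0`. -/
theorem stmt_1 (r z : ℝ) (hr : 1 < r) (hz : 1 ≤ z) (hzr : z < r)
    (hrz : r < ((z + 1) / 2) ^ 2) :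
    (∃ ε > (0 : ℝ), ∀ θ : ℝ, θ ≠ thetaStar z r → |θ - thetaStar z r| < ε →
        laadLoss r z (thetaStar z r) < laadLoss r z θ) ∧
    (∀ θhat : ℝ, (∀ θ : ℝ, laadLoss r z θhat ≤ laadLoss r z θ) →
        θhat = 0 ∨ θhat = thetaStar z r) ∧
    (laadDelta z r < 0 →
      ∀ θ : ℝ, θ ≠ thetaStar z r → laadLoss r z (thetaStar z r) < laadLoss r z θ) ∧
    (0 < laadDelta z r →
      ∀ θ : ℝ, θ ≠ 0 → laadLoss r z 0 < laadLoss r z θ) := by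
  obtain ⟨a, ha0, hab, hzero, hstar⟩ := exists_laadLoss_threshold hz hzr hrz
  have hΔ := laadDelta_eq_sub (ha0.trans hab).le
  refine ⟨⟨thetaStar z r - a, sub_pos.2 hab, fun θ hne hθ => ?_⟩, fun θ hmin => ?_,
    fun hneg θ hne => ?_, fun hpos θ hne => ?_⟩
  · exact hstar θ hne (by linarith [(abs_lt.1 hθ).1])
  · by_contra! hne
    rcases le_total θ a with h | h
    · exact (hzero θ hne.1 h).not_ge (hmin 0)
    · exact (hstar θ hne.2 h).not_ge (hmin _)
  · rcases le_total θ a with h | h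
    · rcases eq_or_ne θ 0 with rfl | h0
      · linarith
      · linarith [hzero θ h0 h]
    · exact hstar θ hne h
  · rcases le_total θ a with h | h
    · exact hzero θ hne h
    · rcases eq_or_ne θ (thetaStar z r) with rfl | h0
      · linarith
      · linarith [hstar θ h0 h]
end

section
/- Let 0 < r ≤ z. Then θ*(z, r) = (z − 1)/2 + (1/2)√((z − 1)² + 4z − 4r) is the unique global minimizer over ℝ of the function θ ↦ ℓ(θ | r, z). -/
/-- On `[0, ∞)` the loss has derivative `(x - z) + r / (1 + x)`. -/
theorem hasDerivAt_smooth_laadLoss (r z x : ℝ) (hx : 0 < 1 + x) :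
    HasDerivAt (fun θ : ℝ => (1 / 2) * (z - θ) ^ 2 + r * Real.log (1 + θ))
      ((x - z) + r / (1 + x)) x := by
  have h1 : HasDerivAt (fun θ : ℝ => z - θ) (-1) x := (hasDerivAt_id x).const_sub z
  have h2 : HasDerivAt (fun θ : ℝ => 1 + θ) 1 x := (hasDerivAt_id x).const_add 1
  refine (((h1.pow 2).const_mul (1 / 2)).add
    ((h2.log hx.ne').const_mul r)).congr_deriv ?_
  norm_num
  ring

theorem laadLoss_of_nonneg (r z : ℝ) {θ : ℝ} (hθ : 0 ≤ θ) :
    laadLoss r z θ = (1 / 2) * (z - θ) ^ 2 + r * Real.log (1 + θ) := by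
  rw [laadLoss, abs_of_nonneg hθ]

/-- `θ*` is a root of the stationarity equation `θ² + (1 - z) θ + r - z = 0`, and it dominates
both `0` and `z - 1`. -/
theorem thetaStar_spec {r z : ℝ} (hrz : r ≤ z) :
    0 ≤ thetaStar z r ∧ z - 1 ≤ thetaStar z r ∧
      thetaStar z r ^ 2 + (1 - z) * thetaStar z r + r - z = 0 := by
  have hD : 0 ≤ (z - 1) ^ 2 + 4 * z - 4 * r := by nlinarith [sq_nonneg (z - 1)]
  have hs := Real.sq_sqrt hD
  have habs : |z - 1| ≤ √((z - 1) ^ 2 + 4 * z - 4 * r) := by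
    apply Real.abs_le_sqrt
    linarith
  obtain ⟨h1, h2⟩ := abs_le.mp habs
  unfold thetaStar
  refine ⟨by linarith, by linarith, by nlinarith⟩

theorem laadLoss_thetaStar_lt_of_nonneg {r z θ : ℝ} (hrz : r ≤ z) (hθ : 0 ≤ θ)
    (hne : θ ≠ thetaStar z r) : laadLoss r z (thetaStar z r) < laadLoss r z θ := by
  obtain ⟨ha, haz, hroot⟩ := thetaStar_spec hrz
  rw [laadLoss_of_nonneg r z ha, laadLoss_of_nonneg r z hθ]
  generalize thetaStar z r = a at *
  have hderiv : ∀ x : ℝ, 0 < x →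
      deriv (fun θ : ℝ => (1 / 2) * (z - θ) ^ 2 + r * Real.log (1 + θ)) x =
        (x - a) * ((x + a + 1 - z) / (1 + x)) := by
    intro x hx
    rw [(hasDerivAt_smooth_laadLoss r z x (by linarith)).deriv]
    field_simp
    linear_combination hroot
  have hcont : ∀ s : Set ℝ, (∀ x ∈ s, 0 ≤ x) →
      ContinuousOn (fun θ : ℝ => (1 / 2) * (z - θ) ^ 2 + r * Real.log (1 + θ)) s :=
    fun s hs x hx => (hasDerivAt_smooth_laadLoss r z x
      (by linarith [hs x hx])).continuousAt.continuousWithinAt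
  rcases lt_or_gt_of_ne hne with hlt | hgt
  · refine strictAntiOn_of_deriv_neg (convex_Icc 0 a) (hcont _ fun x hx => hx.1) ?_
      ⟨hθ, hlt.le⟩ ⟨ha, le_rfl⟩ hlt
    intro x hx
    rw [interior_Icc] at hx
    rw [hderiv x hx.1]
    exact mul_neg_of_neg_of_pos (by linarith [hx.2])
      (div_pos (by linarith [hx.1]) (by linarith [hx.1]))
  · refine strictMonoOn_of_deriv_pos (convex_Ici a) (hcont _ fun x hx => ha.trans hx) ?_
      (Set.mem_Ici.mpr le_rfl) (Set.mem_Ici.mpr hgt.le) hgt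
    intro x hx
    rw [interior_Ici] at hx
    have hax : a < x := hx
    rw [hderiv x (by linarith)]
    exact mul_pos (by linarith) (div_pos (by linarith) (by linarith))

/-- Reflecting a negative point to the positive side strictly lowers the loss when `z > 0`. -/
theorem laadLoss_neg_lt {r z θ : ℝ} (hz : 0 < z) (hθ : θ < 0) :
    laadLoss r z (-θ) < laadLoss r z θ := by
  unfold laadLoss
  rw [abs_neg]
  nlinarith [mul_neg_of_pos_of_neg hz hθ]

/-- For `0 < r ≤ z`, `θ*(z, r)` is the unique global minimizer over ℝ of
`θ ↦ ℓ(θ | r, z)`. -/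
theorem stmt_2 (r z : ℝ) (hr : 0 < r) (hrz : r ≤ z) :
    ∀ θ : ℝ, θ ≠ thetaStar z r → laadLoss r z (thetaStar z r) < laadLoss r z θ := by
  intro θ hne
  rcases le_or_gt 0 θ with hθ | hθ
  · exact laadLoss_thetaStar_lt_of_nonneg hrz hθ hne
  · refine lt_of_le_of_lt ?_ (laadLoss_neg_lt (hr.trans_le hrz) hθ)
    rcases eq_or_ne (-θ) (thetaStar z r) with h | h
    · rw [h]
    · exact (laadLoss_thetaStar_lt_of_nonneg hrz (by linarith) h).le
end

section
/- Fix r > 0. On the set of z ≥ 0 with (z + 1)² > 4r, the function z ↦ Δ(z | r) is differentiable with derivative Δ'(z | r) = −θ*(z, r). In particular, Δ(· | r) is strictly decreasing on any subinterval of this set on which θ*(z, r) > 0. -/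
theorem one_add_thetaStar_pos {z : ℝ} (r : ℝ) (hz : 0 ≤ z) : 0 < 1 + thetaStar z r := by
  unfold thetaStar
  linarith [Real.sqrt_nonneg ((z - 1) ^ 2 + 4 * z - 4 * r)]

/-- `θ*(z, r)` is a root of the stationarity equation `(z − θ)(1 + θ) = r`. -/
theorem sub_thetaStar_mul_one_add_thetaStar {z r : ℝ} (h : 4 * r ≤ (z + 1) ^ 2) :
    (z - thetaStar z r) * (1 + thetaStar z r) = r := by
  have hsq := Real.sq_sqrt (show 0 ≤ (z - 1) ^ 2 + 4 * z - 4 * r by linarith)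
  unfold thetaStar
  linear_combination -(1 / 4) * hsq

theorem differentiableAt_thetaStar {z r : ℝ} (h : 4 * r < (z + 1) ^ 2) :
    DifferentiableAt ℝ (fun w => thetaStar w r) z := by
  have hne : (z - 1) ^ 2 + 4 * z - 4 * r ≠ 0 := by linarith
  unfold thetaStar
  fun_prop (disch := assumption)

theorem hasDerivAt_laadDelta {z r : ℝ} (hz : 0 ≤ z) (h : 4 * r < (z + 1) ^ 2) :
    HasDerivAt (fun w => laadDelta w r) (-(thetaStar z r)) z := by
  have hpos := one_add_thetaStar_pos r hz
  have hθ := (differentiableAt_thetaStar h).hasDerivAt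
  have hlog : r / (1 + thetaStar z r) = z - thetaStar z r :=
    (eq_div_of_mul_eq hpos.ne' (sub_thetaStar_mul_one_add_thetaStar h.le)).symm
  refine ((((hθ.pow 2).const_mul (1 / 2)).sub (hθ.mul (hasDerivAt_id z))).add
    (((hθ.const_add 1).log hpos.ne').const_mul r)).congr_deriv ?_
  simp only [id]
  push_cast
  linear_combination deriv (fun w => thetaStar w r) z * hlog

/-- Fix `r > 0`. On the set of `z ≥ 0` with `(z + 1)² > 4r`, `z ↦ Δ(z | r)` is
differentiable with derivative `−θ*(z, r)`; in particular it is strictly decreasing on any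
subinterval of this set on which `θ*(z, r) > 0`. -/
theorem stmt_7 (r : ℝ) (hr : 0 < r) :
    (∀ z : ℝ, 0 ≤ z → 4 * r < (z + 1) ^ 2 →
      HasDerivAt (fun w => laadDelta w r) (-(thetaStar z r)) z) ∧
    (∀ s : Set ℝ, s.OrdConnected → (∀ z ∈ s, 0 ≤ z ∧ 4 * r < (z + 1) ^ 2) →
      (∀ z ∈ s, 0 < thetaStar z r) →
      StrictAntiOn (fun w => laadDelta w r) s) := by
  refine ⟨fun z hz h => hasDerivAt_laadDelta hz h, fun s hs hdom hpos => ?_⟩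
  have hderiv : ∀ z ∈ s, HasDerivAt (fun w => laadDelta w r) (-(thetaStar z r)) z :=
    fun z hz => hasDerivAt_laadDelta (hdom z hz).1 (hdom z hz).2
  refine strictAntiOn_of_deriv_neg hs.convex
    (fun z hz => (hderiv z hz).continuousAt.continuousWithinAt) fun z hz => ?_
  have hzs := interior_subset hz
  rw [(hderiv z hzs).deriv]
  exact neg_lt_zero.mpr (hpos z hzs)
end

section
/- Let r > 1. Then Δ(2√r − 1 | r) > 0, Δ(r | r) < 0, Δ(· | r) is strictly decreasing on the interval [2√r − 1, r], and consequently Δ(· | r) has exactly one zero z*(r) in the open interval (2√r − 1, r). -/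
lemma one_sub_inv_add_sq_lt_log {x : ℝ} (hx : 1 < x) :
    1 - x⁻¹ + (1 - x⁻¹) ^ 2 / 2 < Real.log x := by
  have hinv : x⁻¹ < 1 := inv_lt_one_of_one_lt₀ hx
  have hy0 : 0 < 1 - x⁻¹ := sub_pos.2 hinv
  have hy1 : |1 - x⁻¹| < 1 := by
    rw [abs_of_pos hy0]
    linarith [inv_pos.2 (zero_lt_one.trans hx)]
  have h := sum_le_hasSum (Finset.range 3) (fun n _ => by positivity)
    (Real.hasSum_pow_div_log_of_abs_lt_one hy1)
  rw [sub_sub_cancel, Real.log_inv, neg_neg] at h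
  norm_num [Finset.sum_range_succ] at h
  linarith [pow_pos hy0 3]

lemma log_lt_half_sub_inv {x : ℝ} (hx : 1 < x) : Real.log x < (x - x⁻¹) / 2 := by
  have h : StrictAntiOn (fun y : ℝ => Real.log y - (y - y⁻¹) / 2) (Set.Ici 1) := by
    apply strictAntiOn_of_hasDerivWithinAt_neg (convex_Ici 1)
      (f' := fun y : ℝ => y⁻¹ - (1 - -(y ^ 2)⁻¹) / 2)
    · intro y hy
      have hy0 : y ≠ 0 := (zero_lt_one.trans_le hy).ne'
      exact ((Real.continuousAt_log hy0).sub
        ((continuousAt_id.sub (continuousAt_inv₀ hy0)).div_const 2)).continuousWithinAt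
    · intro y hy
      rw [interior_Ici] at hy
      have hy0 : y ≠ 0 := (zero_lt_one.trans hy).ne'
      exact ((Real.hasDerivAt_log hy0).sub
        (((hasDerivAt_id y).sub (hasDerivAt_inv hy0)).div_const 2)).hasDerivWithinAt
    · intro y hy
      rw [interior_Ici] at hy
      have hy1 : y⁻¹ < 1 := inv_lt_one_of_one_lt₀ hy
      rw [← inv_pow]
      nlinarith [mul_pos (sub_pos.2 hy1) (sub_pos.2 hy1)]
  have := h Set.self_mem_Ici hx.le hx
  norm_num at this
  linarith

/-- The value of `laadDelta z r` as a function of `u = 1 + thetaStar z r`. -/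
noncomputable def deltaOfShift (r u : ℝ) : ℝ :=
  -(u - 1) ^ 2 / 2 - r * (1 - u⁻¹) + r * Real.log u

lemma strictAntiOn_deltaOfShift {r : ℝ} (hr : 1 < r) :
    StrictAntiOn (deltaOfShift r) (Set.Ici (Real.sqrt r)) := by
  have hs : 1 < Real.sqrt r := Real.lt_sqrt_of_sq_lt (by simpa using hr)
  unfold deltaOfShift
  apply strictAntiOn_of_hasDerivWithinAt_neg (convex_Ici _)
    (f' := fun u : ℝ => -(u - 1) - r * (u ^ 2)⁻¹ + r * u⁻¹)
  · intro u hu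
    have hu0 : u ≠ 0 := (zero_lt_one.trans (hs.trans_le hu)).ne'
    apply ContinuousAt.continuousWithinAt
    fun_prop (disch := assumption)
  · intro u hu
    rw [interior_Ici] at hu
    have hu0 : u ≠ 0 := (zero_lt_one.trans (hs.trans hu)).ne'
    have h := (((((hasDerivAt_id u).sub_const 1).pow 2).neg.div_const 2).sub
      (((hasDerivAt_inv hu0).const_sub 1).const_mul r)).add
      ((Real.hasDerivAt_log hu0).const_mul r)
    refine (h.congr_deriv ?_).hasDerivWithinAt
    simp
    ring
  · intro u hu
    rw [interior_Ici] at hu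
    have hu1 : 1 < u := hs.trans hu
    have hu0 : u ≠ 0 := (zero_lt_one.trans hu1).ne'
    have hru : r < u ^ 2 := (Real.sqrt_lt' (zero_lt_one.trans hu1)).1 hu
    have h : -(u - 1) - r * (u ^ 2)⁻¹ + r * u⁻¹ = (u - 1) * (r - u ^ 2) / u ^ 2 := by
      field_simp
      ring
    rw [h]
    exact div_neg_of_neg_of_pos (mul_neg_of_pos_of_neg (by linarith) (by linarith)) (by positivity)

lemma continuous_thetaStar (r : ℝ) : Continuous fun z => thetaStar z r := by
  unfold thetaStar
  fun_prop

lemma sqrt_le_one_add_thetaStar {z r : ℝ} (hz : 2 * Real.sqrt r - 1 ≤ z) :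
    Real.sqrt r ≤ 1 + thetaStar z r := by
  unfold thetaStar
  linarith [Real.sqrt_nonneg ((z - 1) ^ 2 + 4 * z - 4 * r)]

lemma strictMonoOn_thetaStar (r : ℝ) :
    StrictMonoOn (fun z => thetaStar z r) (Set.Ici (2 * Real.sqrt r - 1)) := by
  intro a ha b hb hab
  have ha' : 2 * Real.sqrt r - 1 ≤ a := ha
  have h : Real.sqrt ((a - 1) ^ 2 + 4 * a - 4 * r) ≤ Real.sqrt ((b - 1) ^ 2 + 4 * b - 4 * r) := by
    apply Real.sqrt_le_sqrt
    nlinarith [Real.sqrt_nonneg r]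
  simp only [thetaStar]
  linarith

lemma laadDelta_eq_deltaOfShift {z r : ℝ} (hr : 0 < r) (hz : 2 * Real.sqrt r - 1 ≤ z) :
    laadDelta z r = deltaOfShift r (1 + thetaStar z r) := by
  have hs : 0 < Real.sqrt r := Real.sqrt_pos.2 hr
  have hu : 0 < 1 + thetaStar z r := hs.trans_le (sqrt_le_one_add_thetaStar hz)
  have hd : 0 ≤ (z - 1) ^ 2 + 4 * z - 4 * r := by
    nlinarith [Real.sq_sqrt hr.le]
  have hq : (1 + thetaStar z r) * thetaStar z r + r = z * (1 + thetaStar z r) := by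
    unfold thetaStar
    nlinarith [Real.sq_sqrt hd]
  unfold laadDelta deltaOfShift
  field_simp
  linear_combination 2 * thetaStar z r * hq

lemma thetaStar_two_mul_sqrt_sub_one {r : ℝ} (hr : 0 ≤ r) :
    1 + thetaStar (2 * Real.sqrt r - 1) r = Real.sqrt r := by
  have h : (2 * Real.sqrt r - 1 - 1) ^ 2 + 4 * (2 * Real.sqrt r - 1) - 4 * r = 0 := by
    linear_combination 4 * Real.sq_sqrt hr
  rw [thetaStar, h, Real.sqrt_zero]
  ring

lemma thetaStar_self {r : ℝ} (hr : 1 ≤ r) : 1 + thetaStar r r = r := by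
  rw [thetaStar, add_sub_cancel_right, Real.sqrt_sq (by linarith)]
  ring

/-- For `r > 1`: `Δ(2√r − 1 | r) > 0`, `Δ(r | r) < 0`, `Δ(· | r)` is strictly decreasing
on `[2√r − 1, r]`, and `Δ(· | r)` has exactly one zero in `(2√r − 1, r)`. -/
theorem stmt_8 (r : ℝ) (hr : 1 < r) :
    0 < laadDelta (2 * Real.sqrt r - 1) r ∧
    laadDelta r r < 0 ∧
    StrictAntiOn (fun z => laadDelta z r) (Set.Icc (2 * Real.sqrt r - 1) r) ∧
    (∃! z : ℝ, z ∈ Set.Ioo (2 * Real.sqrt r - 1) r ∧ laadDelta z r = 0) := by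
  have hr0 : 0 < r := zero_lt_one.trans hr
  have hs : 1 < Real.sqrt r := Real.lt_sqrt_of_sq_lt (by simpa using hr)
  have hsq : Real.sqrt r ^ 2 = r := Real.sq_sqrt hr0.le
  have hle : 2 * Real.sqrt r - 1 ≤ r := by nlinarith [sq_nonneg (Real.sqrt r - 1)]
  have hpos : 0 < laadDelta (2 * Real.sqrt r - 1) r := by
    rw [laadDelta_eq_deltaOfShift hr0 le_rfl, thetaStar_two_mul_sqrt_sub_one hr0.le, deltaOfShift]
    have hlog := one_sub_inv_add_sq_lt_log hs
    have h := mul_lt_mul_of_pos_left hlog hr0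
    have hinv : r * (Real.sqrt r)⁻¹ = Real.sqrt r := by
      rw [← div_eq_mul_inv, Real.div_sqrt]
    have hsub : r * (1 - (Real.sqrt r)⁻¹) ^ 2 = (Real.sqrt r - 1) ^ 2 := by
      nth_rewrite 1 [← hsq]
      field_simp
    linarith
  have hneg : laadDelta r r < 0 := by
    rw [laadDelta_eq_deltaOfShift hr0 hle, thetaStar_self hr.le, deltaOfShift]
    have h := mul_lt_mul_of_pos_left (log_lt_half_sub_inv hr) hr0
    have hinv : r * r⁻¹ = 1 := mul_inv_cancel₀ hr0.ne'
    nlinarith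
  have hanti : StrictAntiOn (fun z => laadDelta z r) (Set.Icc (2 * Real.sqrt r - 1) r) := by
    intro a ha b hb hab
    simp only [laadDelta_eq_deltaOfShift hr0 ha.1, laadDelta_eq_deltaOfShift hr0 hb.1]
    exact strictAntiOn_deltaOfShift hr (sqrt_le_one_add_thetaStar ha.1)
      (sqrt_le_one_add_thetaStar hb.1)
      (add_lt_add_right (strictMonoOn_thetaStar r ha.1 hb.1 hab) 1)
  refine ⟨hpos, hneg, hanti, ?_⟩
  have hcont : ContinuousOn (fun z => laadDelta z r) (Set.Icc (2 * Real.sqrt r - 1) r) := by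
    have hθ := (continuous_thetaStar r).continuousOn (s := Set.Icc (2 * Real.sqrt r - 1) r)
    have hlog := (continuousOn_const (c := (1 : ℝ)).add hθ).log fun z hz =>
      (zero_lt_one.trans (hs.trans_le (sqrt_le_one_add_thetaStar hz.1))).ne'
    exact ((continuousOn_const.mul (hθ.pow 2)).sub (hθ.mul continuousOn_id)).add
      (continuousOn_const.mul hlog)
  obtain ⟨z, hz, hz0⟩ := intermediate_value_Ioo' hle hcont ⟨hneg, hpos⟩
  exact ⟨z, ⟨hz, hz0⟩, fun y hy => hanti.injOn (Set.Ioo_subset_Icc_self hy.1)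
    (Set.Ioo_subset_Icc_self hz) (hy.2.trans hz0.symm)⟩
end
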